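/- Let d ≥ 2 and μ ≥ 1 be integers and let A, B : ℕ → ℤ be sequences with 0 ≤ A(i) ≤ μ and 0 ≤ B(i) ≤ μ for all i, such that DS(A,d) < DS(B,d). Then there exist integer-valued sequences C, X : ℕ → ℤ such that: (1) A(0) + C(0) + X(0) = B(0); (2) for all i ≥ 1, A(i) + C(i) + X(i) = B(i) + d·X(i−1); (3) 0 ≤ C(0) ≤ μ·d/(d−1) and 0 ≤ C(i) < d for all i ≥ 1; and (4) |X(i)| ≤ 1 + μ/(d−1) for all i ≥ 0. -/

import Mathlib

theorem summable_intCast_div_pow_of_abs_le {d m : ℝ} (hd : 1 < d) {D : ℕ → ℤ}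
    (hD : ∀ i, |(D i : ℝ)| ≤ m) : Summable fun k : ℕ => (D k : ℝ) / d ^ k := by
  have hd0 : 0 < d := by linarith
  refine Summable.of_norm_bounded
    ((summable_geometric_of_lt_one (inv_nonneg.2 hd0.le) (inv_lt_one_of_one_lt₀ hd)).mul_left m)
    fun k => ?_
  rw [Real.norm_eq_abs, abs_div, abs_of_pos (pow_pos hd0 k), inv_pow, ← div_eq_mul_inv]
  gcongr
  exact hD k

theorem abs_tsum_intCast_div_pow_le {d m : ℝ} (hd : 1 < d) {D : ℕ → ℤ}
    (hD : ∀ i, |(D i : ℝ)| ≤ m) : |∑' k : ℕ, (D k : ℝ) / d ^ k| ≤ m * d / (d - 1) := by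
  have hd0 : 0 < d := by linarith
  have hd1 : d - 1 ≠ 0 := by linarith
  have hgeom := (hasSum_geometric_of_lt_one (inv_nonneg.2 hd0.le)
    (inv_lt_one_of_one_lt₀ hd)).mul_left m
  have heq : m * (1 - d⁻¹)⁻¹ = m * d / (d - 1) := by
    rw [show 1 - d⁻¹ = (d - 1) / d by field_simp, inv_div, mul_div_assoc]
  rw [heq] at hgeom
  rw [← Real.norm_eq_abs]
  refine tsum_of_norm_bounded hgeom fun k => ?_
  rw [Real.norm_eq_abs, abs_div, abs_of_pos (pow_pos hd0 k), inv_pow, ← div_eq_mul_inv]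
  gcongr
  exact hD k

theorem tsum_intCast_div_pow_succ {d m : ℝ} (hd : 1 < d) {D : ℕ → ℤ}
    (hD : ∀ i, |(D i : ℝ)| ≤ m) :
    ∑' k : ℕ, (D k : ℝ) / d ^ k = D 0 + (∑' k : ℕ, (D (k + 1) : ℝ) / d ^ k) / d := by
  rw [(summable_intCast_div_pow_of_abs_le hd hD).tsum_eq_zero_add, ← tsum_div_const]
  simp [pow_succ, div_div]

/-- The scaled remainders in the base-`d` expansion of `x`, whose integer parts are its digits. -/
noncomputable def expansionRemainder (d x : ℝ) : ℕ → ℝ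
  | 0 => x
  | n + 1 => d * Int.fract (expansionRemainder d x n)

/-- The carries obtained from the digit differences `D` and the digits `C` in base `d`. -/
def carry (d : ℤ) (D C : ℕ → ℤ) : ℕ → ℤ
  | 0 => D 0 - C 0
  | n + 1 => D (n + 1) - C (n + 1) + d * carry d D C n

theorem expansionRemainder_succ_nonneg {d : ℝ} (hd : 0 < d) (x : ℝ) (n : ℕ) :
    0 ≤ expansionRemainder d x (n + 1) :=
  mul_nonneg hd.le (Int.fract_nonneg _)

theorem expansionRemainder_succ_lt {d : ℝ} (hd : 0 < d) (x : ℝ) (n : ℕ) :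
    expansionRemainder d x (n + 1) < d :=
  mul_lt_of_lt_one_right hd (Int.fract_lt_one _)

theorem mul_carry_eq {d : ℤ} (hd : (d : ℝ) ≠ 0) {D : ℕ → ℤ} {T : ℕ → ℝ}
    (hT : ∀ n, T n = D n + T (n + 1) / d) (n : ℕ) :
    (d : ℝ) * carry d D (fun i => ⌊expansionRemainder d (T 0) i⌋) n =
      expansionRemainder d (T 0) (n + 1) - T (n + 1) := by
  have hstep : ∀ i, T (i + 1) = d * (T i - D i) := fun i => by
    rw [hT i]; field_simp; ring
  induction n with
  | zero =>
    simp only [carry, expansionRemainder, Int.fract, hstep 0]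
    push_cast
    ring
  | succ n ih =>
    have hR : expansionRemainder d (T 0) (n + 1 + 1) = d * (expansionRemainder d (T 0) (n + 1) -
        ⌊expansionRemainder d (T 0) (n + 1)⌋) := rfl
    rw [carry, hR, hstep (n + 1)]
    push_cast
    rw [ih]
    ring

/-- Let `d ≥ 2` and `μ ≥ 1` be integers and `A, B : ℕ → ℤ` sequences with
`0 ≤ A(i) ≤ μ` and `0 ≤ B(i) ≤ μ` for all `i`, such that `DS(A,d) < DS(B,d)` where
`DS(A,d) = ∑' i, A i / d ^ i`. Then there exist integer sequences `C, X` satisfying the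
defining equations of the DS-comparator together with the stated bounds. -/
theorem exists_c_x_sequences (d μ : ℤ) (hd : 2 ≤ d) (hμ : 1 ≤ μ) (A B : ℕ → ℤ)
    (hA : ∀ i : ℕ, 0 ≤ A i ∧ A i ≤ μ) (hB : ∀ i : ℕ, 0 ≤ B i ∧ B i ≤ μ)
    (hlt : (∑' i : ℕ, (A i : ℝ) / (d : ℝ) ^ i) < ∑' i : ℕ, (B i : ℝ) / (d : ℝ) ^ i) :
    ∃ C X : ℕ → ℤ,
      (A 0 + C 0 + X 0 = B 0) ∧
      (∀ i : ℕ, 1 ≤ i → A i + C i + X i = B i + d * X (i - 1)) ∧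
      (0 ≤ C 0 ∧ (C 0 : ℝ) ≤ (μ : ℝ) * (d : ℝ) / ((d : ℝ) - 1) ∧
        ∀ i : ℕ, 1 ≤ i → 0 ≤ C i ∧ C i < d) ∧
      (∀ i : ℕ, (|X i| : ℝ) ≤ 1 + (μ : ℝ) / ((d : ℝ) - 1)) := by
  have hd' : (2 : ℝ) ≤ d := by exact_mod_cast hd
  have hd1 : (1 : ℝ) < d := by linarith
  have hd0 : (0 : ℝ) < d := by linarith
  have hbound : ∀ {F : ℕ → ℤ}, (∀ i, 0 ≤ F i ∧ F i ≤ μ) → ∀ i, |(F i : ℝ)| ≤ μ := by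
    intro F hF i
    rw [abs_le]
    have := hF i
    constructor <;> norm_cast <;> omega
  set D : ℕ → ℤ := fun i => B i - A i with hDdef
  have hD : ∀ i, |(D i : ℝ)| ≤ μ := by
    intro i
    rw [abs_le]
    have := hA i
    have := hB i
    constructor <;> norm_cast <;> simp only [hDdef] <;> omega
  set T : ℕ → ℝ := fun n => ∑' k : ℕ, (D (k + n) : ℝ) / (d : ℝ) ^ k with hTdef
  have hT : ∀ n, T n = D n + T (n + 1) / d := by
    intro n
    have h := tsum_intCast_div_pow_succ hd1 (D := fun k => D (k + n)) fun i => hD _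
    simpa only [hTdef, zero_add, add_assoc, add_comm 1 n] using h
  have hTle : ∀ n, |T n| ≤ μ * d / (d - 1) := fun n =>
    abs_tsum_intCast_div_pow_le hd1 (D := fun k => D (k + n)) fun i => hD _
  have hT0 : 0 < T 0 := by
    have h := (summable_intCast_div_pow_of_abs_le hd1 (hbound hB)).tsum_sub
      (summable_intCast_div_pow_of_abs_le hd1 (hbound hA))
    have h0 : T 0 = ∑' k : ℕ, ((B k : ℝ) / (d : ℝ) ^ k - (A k : ℝ) / (d : ℝ) ^ k) := by
      simp only [hTdef, hDdef, add_zero, Int.cast_sub, sub_div]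
    rw [h0, h]
    exact sub_pos.2 hlt
  set C : ℕ → ℤ := fun i => ⌊expansionRemainder d (T 0) i⌋ with hC
  refine ⟨C, carry d D C, ?_, ?_, ⟨Int.floor_nonneg.2 hT0.le, ?_, ?_⟩, ?_⟩
  · simp only [carry, hDdef]
    ring
  · rintro (_ | i) hi
    · omega
    · simp only [carry, hDdef, Nat.add_sub_cancel]
      ring
  · exact (Int.floor_le _).trans ((le_abs_self _).trans (hTle 0))
  · rintro (_ | i) hi
    · omega
    · exact ⟨Int.floor_nonneg.2 (expansionRemainder_succ_nonneg hd0 _ i),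
        Int.floor_lt.2 (expansionRemainder_succ_lt hd0 _ i)⟩
  · intro i
    have hX := mul_carry_eq hd0.ne' hT i
    have h0 := expansionRemainder_succ_nonneg hd0 (T 0) i
    have h1 := expansionRemainder_succ_lt hd0 (T 0) i
    have h2 := abs_le.1 (hTle (i + 1))
    have habs : |(d : ℝ) * carry d D C i| ≤ d + μ * d / (d - 1) := by
      rw [hX, abs_le]
      constructor <;> linarith
    rw [abs_mul, abs_of_pos hd0] at habs
    refine le_of_mul_le_mul_left (habs.trans_eq ?_) hd0
    ring
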